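/- There exist constants C > 0, ε ∈ (0,1) and σ₀ > 0, depending on n and g₀,…,g_n, such that for all q ∈ (0,1) with q̂ = 1 − q ≤ ε and all σ ≥ σ₀: E_{P_{q,σ}}[ |L_{q,σ} − E_{P_{q,σ}}[L_{q,σ}]|³ ] ≤ (2 − q³)·√(8/π)·μ³/σ³ + C·(q̂/σ⁴ + q̂²), and likewise E_{Q_{q,σ}}[ |L_{q,σ} − E_{Q_{q,σ}}[L_{q,σ}]|³ ] ≤ (2 − q³)·√(8/π)·μ³/σ³ + C·(q̂/σ⁴ + q̂²). -/

import Mathlib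

open MeasureTheory ProbabilityTheory

/-- The summation dataset function `h(J) = Σ_{j∈J} g j`. -/
noncomputable def sumFn (g : ℕ → ℝ) : Finset ℕ → ℝ := fun J => ∑ j ∈ J, g j

/-- The Poisson-subsampled Gaussian output distribution on the dataset `S = {0,…,n}`:
`P_{q,σ} = Σ_{J ⊆ {0,…,n}} q^{|J|} (1−q)^{n+1−|J|} · N(h(J), σ²)`. -/
noncomputable def subsampledP (n : ℕ) (σ q : ℝ) (h : Finset ℕ → ℝ) : Measure ℝ :=
  ∑ J ∈ (Finset.range (n + 1)).powerset,
    ENNReal.ofReal (q ^ J.card * (1 - q) ^ (n + 1 - J.card)) •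
      gaussianReal (h J) (σ ^ 2).toNNReal

/-- The Poisson-subsampled Gaussian output distribution on the dataset
`S⁻ = {0,…,n−1}`:
`Q_{q,σ} = Σ_{J ⊆ {0,…,n−1}} q^{|J|} (1−q)^{n−|J|} · N(h(J), σ²)`. -/
noncomputable def subsampledQ (n : ℕ) (σ q : ℝ) (h : Finset ℕ → ℝ) : Measure ℝ :=
  ∑ J ∈ (Finset.range n).powerset,
    ENNReal.ofReal (q ^ J.card * (1 - q) ^ (n - J.card)) •
      gaussianReal (h J) (σ ^ 2).toNNReal

/-- The privacy loss `L_{q,σ} = ln(dP_{q,σ}/dQ_{q,σ})` of the Poisson-subsampled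
Gaussian mechanism. -/
noncomputable def privacyLoss (n : ℕ) (σ q : ℝ) (h : Finset ℕ → ℝ) (y : ℝ) : ℝ :=
  Real.log (((subsampledP n σ q h).rnDeriv (subsampledQ n σ q h) y).toReal)


lemma aux_exp1 (x : ℝ) : |Real.exp x - 1| ≤ |x| * Real.exp |x| := by
  have h := Complex.norm_exp_sub_sum_le_norm_mul_exp (x : ℂ) 1
  simp only [Finset.range_one, Finset.sum_singleton, pow_zero, Nat.factorial_zero, Nat.cast_one,
    div_one, pow_one, Complex.norm_real, Real.norm_eq_abs] at h
  rw [← Complex.ofReal_exp, ← Complex.ofReal_one, ← Complex.ofReal_sub, Complex.norm_real] at h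
  exact h

lemma aux_exp2 (x : ℝ) : |Real.exp x - 1 - x| ≤ |x| ^ 2 * Real.exp |x| := by
  have h := Complex.norm_exp_sub_sum_le_norm_mul_exp (x : ℂ) 2
  simp only [Finset.sum_range_succ, Finset.range_zero, Finset.sum_empty, pow_zero,
    Nat.factorial_zero, Nat.cast_one, div_one, pow_one, Nat.factorial_one, zero_add,
    Complex.norm_real, Real.norm_eq_abs] at h
  rw [← Complex.ofReal_exp, ← Complex.ofReal_one, ← Complex.ofReal_add, ← Complex.ofReal_sub,
    Complex.norm_real, ← sub_sub] at h
  exact h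

lemma aux_log (G : ℝ) (hG : 1 / 2 ≤ G) : |Real.log G - (G - 1)| ≤ 2 * (G - 1) ^ 2 := by
  have h0 : 0 < G := by linarith
  have h1 := Real.log_le_sub_one_of_pos h0
  have h2 := Real.one_sub_inv_le_log_of_pos h0
  have h3 : G - 1 - (1 - G⁻¹) = (G - 1) ^ 2 * G⁻¹ := by field_simp
  have h4 : G⁻¹ ≤ 2 := by
    rw [inv_le_comm₀ h0 (by norm_num)]; linarith
  rw [abs_le]; constructor
  · nlinarith [sq_nonneg (G - 1), mul_le_mul_of_nonneg_left h4 (sq_nonneg (G - 1))]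
  · nlinarith [sq_nonneg (G - 1)]

lemma lemA {ι : Type*} [DecidableEq ι] (s : Finset ι) (w θ : ι → ℝ) (i0 : ι) (hi0 : i0 ∈ s)
    (hw : ∀ i ∈ s, 0 ≤ w i) (hsum : ∑ i ∈ s, w i = 1) (κ t : ℝ) (hhalf : 1 / 2 ≤ w i0)
    (hκ : 1 - w i0 ≤ κ) (hκ1 : κ ≤ 1) (hθ0 : θ i0 = 0) (ht : ∀ i ∈ s, |θ i| ≤ t) :
    |Real.log (∑ i ∈ s, w i * Real.exp (θ i)) - ∑ i ∈ s, w i * θ i|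
      ≤ 3 * κ * (t ^ 2 * Real.exp (2 * t)) := by
  have ht0 : 0 ≤ t := (abs_nonneg _).trans (ht i0 hi0)
  have key : ∀ (F : ι → ℝ) (B : ℝ), 0 ≤ B → F i0 = 0 → (∀ i ∈ s, |F i| ≤ B) →
      |∑ i ∈ s, w i * F i| ≤ κ * B := by
    intro F B hB hF0 hF
    rw [← Finset.add_sum_erase s _ hi0, hF0, mul_zero, zero_add]
    have h1 : ∑ i ∈ s.erase i0, w i = 1 - w i0 := by
      rw [← hsum, ← Finset.add_sum_erase s _ hi0]; ring
    calc |∑ i ∈ s.erase i0, w i * F i| ≤ ∑ i ∈ s.erase i0, |w i * F i| :=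
          Finset.abs_sum_le_sum_abs _ _
      _ ≤ ∑ i ∈ s.erase i0, w i * B := by
          apply Finset.sum_le_sum
          intro i hi
          have his := Finset.mem_of_mem_erase hi
          rw [abs_mul, abs_of_nonneg (hw i his)]
          exact mul_le_mul_of_nonneg_left (hF i his) (hw i his)
      _ = (1 - w i0) * B := by rw [← Finset.sum_mul, h1]
      _ ≤ κ * B := mul_le_mul_of_nonneg_right hκ hB
  set G := ∑ i ∈ s, w i * Real.exp (θ i) with hG
  have hw1 : w i0 ≤ 1 := by
    rw [← hsum]; exact Finset.single_le_sum hw hi0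
  have hκ0 : 0 ≤ κ := by linarith
  have e1 : |G - 1| ≤ κ * (t * Real.exp t) := by
    have : G - 1 = ∑ i ∈ s, w i * (Real.exp (θ i) - 1) := by
      simp only [mul_sub, Finset.sum_sub_distrib, mul_one, hsum, hG]
    rw [this]
    apply key
    · positivity
    · simp [hθ0]
    · intro i hi
      refine (aux_exp1 _).trans ?_
      have := ht i hi
      gcongr
  have e2 : |G - 1 - ∑ i ∈ s, w i * θ i| ≤ κ * (t ^ 2 * Real.exp t) := by
    have : G - 1 - ∑ i ∈ s, w i * θ i = ∑ i ∈ s, w i * (Real.exp (θ i) - 1 - θ i) := by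
      simp only [mul_sub, Finset.sum_sub_distrib, mul_one, hsum, hG]
    rw [this]
    apply key
    · positivity
    · simp [hθ0]
    · intro i hi
      refine (aux_exp2 _).trans ?_
      have := ht i hi
      gcongr
  have hGhalf : 1 / 2 ≤ G := by
    have : w i0 * Real.exp (θ i0) ≤ G :=
      Finset.single_le_sum (f := fun i => w i * Real.exp (θ i))
        (fun i hi => mul_nonneg (hw i hi) (Real.exp_pos _).le) hi0
    rw [hθ0, Real.exp_zero, mul_one] at this
    linarith
  have e3 := aux_log G hGhalf
  have e4 : (G - 1) ^ 2 ≤ κ * (t ^ 2 * Real.exp (2 * t)) := by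
    have : (G - 1) ^ 2 ≤ (κ * (t * Real.exp t)) ^ 2 := sq_le_sq' (by linarith [(abs_le.1 e1).1]) (abs_le.1 e1).2
    have h2 : (κ * (t * Real.exp t)) ^ 2 = κ * (κ * (t ^ 2 * Real.exp (2 * t))) := by
      rw [two_mul, Real.exp_add]; ring
    rw [h2] at this
    refine this.trans (mul_le_mul_of_nonneg_left ?_ hκ0)
    exact mul_le_of_le_one_left (by positivity) hκ1
  have e5 : κ * (t ^ 2 * Real.exp t) ≤ κ * (t ^ 2 * Real.exp (2 * t)) := by
    have : t ≤ 2 * t := by linarith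
    gcongr
  have := abs_add_le (Real.log G - (G - 1)) (G - 1 - ∑ i ∈ s, w i * θ i)
  rw [sub_add_sub_cancel] at this
  linarith

lemma third_abs : ∫ z, |z| ^ 3 ∂(gaussianReal 0 1) = Real.sqrt (8 / Real.pi) := by
  rw [integral_gaussianReal_eq_integral_smul one_ne_zero]
  have h1 : ∀ x : ℝ, gaussianPDFReal 0 1 x • |x| ^ 3
      = (fun y : ℝ => (Real.sqrt (2 * Real.pi))⁻¹ * (y ^ (3:ℝ) * Real.exp (-(1/2) * y ^ (2:ℝ)))) |x| := by
    intro x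
    have e3 : |x| ^ (3:ℝ) = |x| ^ 3 := by exact_mod_cast Real.rpow_natCast |x| 3
    have e2 : |x| ^ (2:ℝ) = x ^ 2 := by
      rw [← sq_abs]; exact_mod_cast Real.rpow_natCast |x| 2
    simp only [gaussianPDFReal, smul_eq_mul, e2, e3]
    simp only [NNReal.coe_one, mul_one, sub_zero]
    rw [show -x ^ 2 / 2 = -(1/2) * x ^ 2 by ring]; ring
  simp_rw [h1]
  rw [integral_comp_abs (f := fun y : ℝ => (Real.sqrt (2 * Real.pi))⁻¹ * (y ^ (3:ℝ) * Real.exp (-(1/2) * y ^ (2:ℝ)))), MeasureTheory.integral_const_mul,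
    integral_rpow_mul_exp_neg_mul_rpow (by norm_num) (by norm_num) (by norm_num)]
  rw [show ((3:ℝ)+1)/2 = 2 by norm_num, show -((3:ℝ)+1)/2 = -2 by norm_num, Real.Gamma_two]
  have : ((1:ℝ)/2) ^ (-2:ℝ) = 4 := by
    rw [Real.rpow_neg (by norm_num)]
    rw [show ((1:ℝ)/2) ^ (2:ℝ) = (1/2)^2 by exact_mod_cast Real.rpow_natCast (1/2:ℝ) 2]; norm_num
  rw [this]
  symm
  rw [Real.sqrt_eq_iff_mul_self_eq (by positivity) (by positivity)]
  have h : Real.sqrt (2 * Real.pi) ^ 2 = 2 * Real.pi := Real.sq_sqrt (by positivity)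
  have hs : 0 < Real.sqrt (2 * Real.pi) := by positivity
  field_simp
  rw [mul_comm Real.pi 2, h]; ring

lemma int_exp_abs (c : ℝ) : Integrable (fun z : ℝ => Real.exp (c * |z|)) (gaussianReal 0 1) :=
  integrable_exp_mul_abs (integrable_exp_mul_gaussianReal c) (integrable_exp_mul_gaussianReal (-c))

lemma gauss_map (m σ : ℝ) : gaussianReal m (σ ^ 2).toNNReal
    = (gaussianReal 0 1).map (fun z => m + σ * z) := by
  have h1 := gaussianReal_map_const_mul (μ := 0) (v := 1) σ
  have h2 := gaussianReal_map_const_add (μ := σ * 0) (v := .mk (σ ^ 2) (sq_nonneg σ) * 1) m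
  rw [← h1, Measure.map_map (by fun_prop) (by fun_prop)] at h2
  have h3 : ((fun x => m + x) ∘ fun x => σ * x) = fun z => m + σ * z := rfl
  rw [h3] at h2
  rw [h2]
  congr 1
  · simp
  · ext; simp [sq_nonneg]

lemma gauss_emb (m σ : ℝ) (hσ : 0 < σ) : MeasurableEmbedding (fun z : ℝ => m + σ * z) :=
  (measurableEmbedding_addLeft m).comp (measurableEmbedding_mulLeft₀ hσ.ne')

lemma gauss_integral (m σ : ℝ) (hσ : 0 < σ) (f : ℝ → ℝ) :
    ∫ y, f y ∂(gaussianReal m (σ ^ 2).toNNReal) = ∫ z, f (m + σ * z) ∂(gaussianReal 0 1) := by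
  rw [gauss_map, (gauss_emb m σ hσ).integral_map]

lemma gauss_integrable (m σ : ℝ) (hσ : 0 < σ) (f : ℝ → ℝ) :
    Integrable f (gaussianReal m (σ ^ 2).toNNReal) ↔
      Integrable (fun z => f (m + σ * z)) (gaussianReal 0 1) := by
  rw [gauss_map, (gauss_emb m σ hσ).integrable_map_iff]; rfl

lemma mix_integral {ι : Type*} (s : Finset ι) (w m : ι → ℝ) (σ : ℝ) (hσ : 0 < σ)
    (hw : ∀ i ∈ s, 0 ≤ w i) (f : ℝ → ℝ)
    (hf : ∀ i ∈ s, Integrable (fun z => f (m i + σ * z)) (gaussianReal 0 1)) :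
    ∫ y, f y ∂(∑ i ∈ s, ENNReal.ofReal (w i) • gaussianReal (m i) (σ ^ 2).toNNReal)
      = ∑ i ∈ s, w i * ∫ z, f (m i + σ * z) ∂(gaussianReal 0 1) := by
  rw [integral_finsetSum_measure]
  · apply Finset.sum_congr rfl
    intro i hi
    rw [integral_smul_measure, gauss_integral _ _ hσ, ENNReal.toReal_ofReal (hw i hi), smul_eq_mul]
  · intro i hi
    exact ((gauss_integrable _ _ hσ f).2 (hf i hi)).smul_measure ENNReal.ofReal_ne_top

set_option maxHeartbeats 800000 in
lemma lemB (ι : Type*) (K c b : ℝ) (hK : 0 ≤ K) (hc : 0 ≤ c) (hb : 0 ≤ b) :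
    ∃ C > (0:ℝ), ∀ (s : Finset ι) (w m κ : ι → ℝ) (σ p β a : ℝ) (L : ℝ → ℝ),
      1 ≤ σ → 0 ≤ p → (∀ i ∈ s, 0 ≤ w i) → ∑ i ∈ s, w i = 1 →
      (∀ i ∈ s, p ≤ κ i) → (∀ i ∈ s, κ i ≤ 1) → ∑ i ∈ s, w i * κ i ≤ K * p → |β| ≤ b →
      Measurable L →
      (∀ i ∈ s, ∀ z, |L (m i + σ * z) - a - β * z / σ| ≤ κ i * (K * Real.exp (c * |z|)) / σ ^ 2) →
      ∫ y, |L y - ∫ x, L x ∂(∑ i ∈ s, ENNReal.ofReal (w i) • gaussianReal (m i) (σ ^ 2).toNNReal)| ^ 3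
        ∂(∑ i ∈ s, ENNReal.ofReal (w i) • gaussianReal (m i) (σ ^ 2).toNNReal)
        ≤ b ^ 3 * Real.sqrt (8 / Real.pi) / σ ^ 3 + C * (p / σ ^ 4) := by
  set M := ∫ z, Real.exp (c * |z|) ∂(gaussianReal 0 1) with hM
  have hM0 : 0 ≤ M := integral_nonneg fun z => (Real.exp_pos _).le
  set K' := K + K * M * K with hK'
  have hK'0 : 0 ≤ K' := by positivity
  set d := c + 2 * (c + 1) with hd
  set M2 := ∫ z, Real.exp (d * |z|) ∂(gaussianReal 0 1) with hM2
  have hM20 : 0 ≤ M2 := integral_nonneg fun z => (Real.exp_pos _).le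
  set K2 := K' * (3 * (b + K') ^ 2) with hK2
  have hK20 : 0 ≤ K2 := by positivity
  refine ⟨K2 * M2 * K + 1, by positivity, ?_⟩
  intro s w m κ σ p β a L hσ hp hw hsum hpκ hκ1 hwκ hβ hL hbd
  have hσ0 : 0 < σ := by linarith
  have hid : Integrable (fun z : ℝ => z) (gaussianReal 0 1) :=
    (memLp_id_gaussianReal (μ := 0) (v := 1) 1).integrable (by simp)
  have hLm : ∀ i, Measurable (fun z => L (m i + σ * z)) := fun i => hL.comp (by fun_prop)
  -- remainder
  have hRint : ∀ i ∈ s, Integrable (fun z => L (m i + σ * z) - a - β * z / σ) (gaussianReal 0 1) := by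
    intro i hi
    refine Integrable.mono' (((int_exp_abs c).const_mul (κ i * K / σ ^ 2))) ?_ ?_
    · exact (((hLm i).sub_const a).sub (by fun_prop)).aestronglyMeasurable
    · refine ae_of_all _ fun z => ?_
      rw [Real.norm_eq_abs]
      refine (hbd i hi z).trans (le_of_eq (by ring))
  have hlin : Integrable (fun z : ℝ => β * z / σ) (gaussianReal 0 1) := by
    have := hid.const_mul (β / σ)
    refine this.congr (ae_of_all _ fun z => by ring)
  have hLint : ∀ i ∈ s, Integrable (fun z => L (m i + σ * z)) (gaussianReal 0 1) := by
    intro i hi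
    have := ((hRint i hi).add hlin).add (integrable_const a)
    refine this.congr (ae_of_all _ fun z => ?_)
    simp only [Pi.add_apply]; ring
  have hLi : ∀ i ∈ s, |∫ z, L (m i + σ * z) ∂(gaussianReal 0 1) - a| ≤ κ i * (K * M) / σ ^ 2 := by
    intro i hi
    have e1 : ∫ z, L (m i + σ * z) ∂(gaussianReal 0 1) - a
        = ∫ z, (L (m i + σ * z) - a - β * z / σ) ∂(gaussianReal 0 1) := by
      have z0 : ∫ z, β * z / σ ∂(gaussianReal 0 1) = 0 := by
        have : ∀ z : ℝ, β * z / σ = (β / σ) * z := fun z => by ring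
        simp_rw [this]
        rw [integral_const_mul, integral_id_gaussianReal, mul_zero]
      have hs1 : Integrable (fun z => L (m i + σ * z) - a) (gaussianReal 0 1) :=
        (hLint i hi).sub (integrable_const a)
      rw [integral_sub hs1 hlin, integral_sub (hLint i hi) (integrable_const a), z0]
      simp
    rw [e1]
    calc _ ≤ ∫ z, |L (m i + σ * z) - a - β * z / σ| ∂(gaussianReal 0 1) := abs_integral_le_integral_abs
      _ ≤ ∫ z, (κ i * K / σ ^ 2) * Real.exp (c * |z|) ∂(gaussianReal 0 1) := by
          apply integral_mono (hRint i hi).abs ((int_exp_abs c).const_mul _)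
          intro z
          exact (hbd i hi z).trans (le_of_eq (by ring))
      _ = _ := by rw [integral_const_mul]; ring
  set E := ∫ x, L x ∂(∑ i ∈ s, ENNReal.ofReal (w i) • gaussianReal (m i) (σ ^ 2).toNNReal) with hE
  have hEa : |E - a| ≤ p * (K * M * K) / σ ^ 2 := by
    rw [hE, mix_integral s w m σ hσ0 hw L hLint]
    have e1 : ∑ i ∈ s, w i * ∫ z, L (m i + σ * z) ∂(gaussianReal 0 1) - a
        = ∑ i ∈ s, w i * (∫ z, L (m i + σ * z) ∂(gaussianReal 0 1) - a) := by
      simp only [mul_sub, Finset.sum_sub_distrib, ← Finset.sum_mul, hsum, one_mul]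
    rw [e1]
    calc _ ≤ ∑ i ∈ s, |w i * (∫ z, L (m i + σ * z) ∂(gaussianReal 0 1) - a)| :=
          Finset.abs_sum_le_sum_abs _ _
      _ ≤ ∑ i ∈ s, (w i * κ i) * (K * M / σ ^ 2) := by
          apply Finset.sum_le_sum
          intro i hi
          rw [abs_mul, abs_of_nonneg (hw i hi)]
          refine (mul_le_mul_of_nonneg_left (hLi i hi) (hw i hi)).trans (le_of_eq (by ring))
      _ = (∑ i ∈ s, w i * κ i) * (K * M / σ ^ 2) := by rw [Finset.sum_mul]
      _ ≤ (K * p) * (K * M / σ ^ 2) := by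
          apply mul_le_mul_of_nonneg_right hwκ; positivity
      _ = _ := by ring
  have hpt : ∀ i ∈ s, ∀ z, |L (m i + σ * z) - E| ^ 3
      ≤ b ^ 3 / σ ^ 3 * |z| ^ 3 + κ i * K2 / σ ^ 4 * Real.exp (d * |z|) := by
    intro i hi z
    have hκ0 : 0 ≤ κ i := hp.trans (hpκ i hi)
    have hec : 1 ≤ Real.exp (c * |z|) := Real.one_le_exp (by positivity)
    have h1 : |L (m i + σ * z) - E| ≤ b * |z| / σ + κ i * (K' * Real.exp (c * |z|)) / σ ^ 2 := by
      have t1 : |β * z / σ| ≤ b * |z| / σ := by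
        rw [abs_div, abs_mul, abs_of_pos hσ0]; gcongr
      have t2 := hbd i hi z
      have t3 : p * (K * M * K) / σ ^ 2 ≤ κ i * (K * M * K * Real.exp (c * |z|)) / σ ^ 2 := by
        have := hpκ i hi
        have : K * M * K ≤ K * M * K * Real.exp (c * |z|) := le_mul_of_one_le_right (by positivity) hec
        gcongr
      have t4 : κ i * (K' * Real.exp (c * |z|)) / σ ^ 2 = κ i * (K * Real.exp (c * |z|)) / σ ^ 2
        + κ i * (K * M * K * Real.exp (c * |z|)) / σ ^ 2 := by rw [hK']; ring
      rw [t4]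
      have t5 : L (m i + σ * z) - E = (L (m i + σ * z) - a - β * z / σ) + β * z / σ - (E - a) := by ring
      rw [t5]
      have t6 := abs_sub ((L (m i + σ * z) - a - β * z / σ) + β * z / σ) (E - a)
      have t7 := abs_add_le (L (m i + σ * z) - a - β * z / σ) (β * z / σ)
      linarith
    set x := b * |z| / σ with hx
    set y := κ i * (K' * Real.exp (c * |z|)) / σ ^ 2 with hy
    have hx0 : 0 ≤ x := by positivity
    have hy0 : 0 ≤ y := by positivity
    have h2 : |L (m i + σ * z) - E| ^ 3 ≤ (x + y) ^ 3 := pow_le_pow_left₀ (abs_nonneg _) h1 3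
    have h3 : (x + y) ^ 3 ≤ x ^ 3 + y * (3 * (x + y) ^ 2) := by
      have e : x ^ 3 + y * (3 * (x + y) ^ 2) - (x + y) ^ 3 = 3 * x * y ^ 2 + 2 * y ^ 3 := by ring
      have : 0 ≤ 3 * x * y ^ 2 + 2 * y ^ 3 := by positivity
      linarith
    have h4 : x + y ≤ (b + K') * Real.exp ((c + 1) * |z|) / σ := by
      have hz : |z| ≤ Real.exp ((c + 1) * |z|) := by
        have := Real.add_one_le_exp ((c + 1) * |z|)
        have h0 := mul_nonneg hc (abs_nonneg z)
        have h1 : (c + 1) * |z| = c * |z| + |z| := by ring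
        linarith
      have hee : Real.exp (c * |z|) ≤ Real.exp ((c + 1) * |z|) := by
        apply Real.exp_le_exp.2
        have h1 : (c + 1) * |z| = c * |z| + |z| := by ring
        linarith [abs_nonneg z]
      have a1 : x ≤ b * Real.exp ((c + 1) * |z|) / σ := by rw [hx]; gcongr
      have a2 : y ≤ K' * Real.exp ((c + 1) * |z|) / σ := by
        have hσ2 : σ ≤ σ ^ 2 := le_self_pow₀ hσ two_ne_zero
        calc y ≤ 1 * (K' * Real.exp ((c + 1) * |z|)) / σ := by
              rw [hy]
              have := hκ1 i hi
              gcongr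
          _ = _ := by ring
      calc x + y ≤ _ := add_le_add a1 a2
        _ = _ := by ring
    have h5 : y * (3 * (x + y) ^ 2) ≤ κ i * K2 / σ ^ 4 * Real.exp (d * |z|) := by
      have : y * (3 * (x + y) ^ 2) ≤ y * (3 * ((b + K') * Real.exp ((c + 1) * |z|) / σ) ^ 2) := by
        gcongr
      refine this.trans (le_of_eq ?_)
      have he : Real.exp (d * |z|) = Real.exp (c * |z|) * Real.exp ((c + 1) * |z|) ^ 2 := by
        rw [← Real.exp_nat_mul, ← Real.exp_add, hd]; congr 1; push_cast; ring
      rw [he, hy, hK2]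
      field_simp
    have h6 : x ^ 3 = b ^ 3 / σ ^ 3 * |z| ^ 3 := by rw [hx]; field_simp
    rw [← h6]; linarith
  have hz3 : Integrable (fun z : ℝ => |z| ^ 3) (gaussianReal 0 1) := by
    by_contra h
    have := integral_undef h
    rw [third_abs] at this
    have : 0 < Real.sqrt (8 / Real.pi) := by positivity
    linarith
  have hdom : ∀ i, Integrable (fun z : ℝ => b ^ 3 / σ ^ 3 * |z| ^ 3 + κ i * K2 / σ ^ 4 * Real.exp (d * |z|))
      (gaussianReal 0 1) := fun i => (hz3.const_mul _).add ((int_exp_abs d).const_mul _)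
  have hint3 : ∀ i ∈ s, Integrable (fun z => |L (m i + σ * z) - E| ^ 3) (gaussianReal 0 1) := by
    intro i hi
    refine Integrable.mono' (hdom i) ?_ ?_
    · have := ((hLm i).sub_const E).abs.pow_const 3
      exact this.aestronglyMeasurable
    · refine ae_of_all _ fun z => ?_
      rw [Real.norm_eq_abs, abs_of_nonneg (by positivity)]
      exact hpt i hi z
  rw [mix_integral s w m σ hσ0 hw (fun y => |L y - E| ^ 3) hint3]
  calc _ ≤ ∑ i ∈ s, w i * (b ^ 3 / σ ^ 3 * Real.sqrt (8 / Real.pi) + κ i * K2 / σ ^ 4 * M2) := by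
        apply Finset.sum_le_sum
        intro i hi
        apply mul_le_mul_of_nonneg_left _ (hw i hi)
        calc _ ≤ ∫ z, (b ^ 3 / σ ^ 3 * |z| ^ 3 + κ i * K2 / σ ^ 4 * Real.exp (d * |z|)) ∂(gaussianReal 0 1) :=
              integral_mono (hint3 i hi) (hdom i) (hpt i hi)
          _ = _ := by
              rw [integral_add (hz3.const_mul _) ((int_exp_abs d).const_mul _), integral_const_mul,
                integral_const_mul, third_abs]
    _ = (∑ i ∈ s, w i) * (b ^ 3 / σ ^ 3 * Real.sqrt (8 / Real.pi)) +
          (∑ i ∈ s, w i * κ i) * (K2 / σ ^ 4 * M2) := by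
        rw [Finset.sum_mul, Finset.sum_mul, ← Finset.sum_add_distrib]
        apply Finset.sum_congr rfl
        intro i _; ring
    _ ≤ 1 * (b ^ 3 / σ ^ 3 * Real.sqrt (8 / Real.pi)) + (K * p) * (K2 / σ ^ 4 * M2) := by
        rw [hsum]; gcongr
    _ ≤ _ := by
        have : 0 ≤ p / σ ^ 4 := by positivity
        have e : b ^ 3 * Real.sqrt (8 / Real.pi) / σ ^ 3 + (K2 * M2 * K + 1) * (p / σ ^ 4)
          = 1 * (b ^ 3 / σ ^ 3 * Real.sqrt (8 / Real.pi)) + (K * p) * (K2 / σ ^ 4 * M2) + p / σ ^ 4 := by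
          ring
        rw [e]; linarith

noncomputable def wt (q : ℝ) (N : ℕ) (J : Finset ℕ) : ℝ := q ^ J.card * (1 - q) ^ (N - J.card)

lemma sum_wt (q : ℝ) (N : ℕ) : ∑ J ∈ (Finset.range N).powerset, wt q N J = 1 := by
  have := Finset.sum_pow_mul_eq_add_pow q (1 - q) (Finset.range N)
  simpa [wt] using this

lemma mean_wt (q : ℝ) (g : ℕ → ℝ) (N : ℕ) :
    ∑ J ∈ (Finset.range N).powerset, wt q N J * sumFn g J = q * ∑ j ∈ Finset.range N, g j := by
  induction N with
  | zero => simp [wt, sumFn]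
  | succ N ih =>
    rw [Finset.range_add_one, Finset.sum_powerset_insert (by simp), Finset.sum_insert (by simp)]
    have e1 : ∀ J ∈ (Finset.range N).powerset, wt q (N + 1) J * sumFn g J
        = (1 - q) * (wt q N J * sumFn g J) := by
      intro J hJ
      have hc : J.card ≤ N := by simpa using Finset.card_le_card (Finset.mem_powerset.1 hJ)
      rw [wt, wt, Nat.succ_sub hc, pow_succ]; ring
    have e2 : ∀ J ∈ (Finset.range N).powerset, wt q (N + 1) (insert N J) * sumFn g (insert N J)
        = q * (wt q N J * sumFn g J) + q * g N * wt q N J := by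
      intro J hJ
      have hn : N ∉ J := fun h => by simpa using Finset.mem_powerset.1 hJ h
      rw [wt, wt, sumFn, Finset.sum_insert hn, Finset.card_insert_of_notMem hn,
        Nat.add_sub_add_right, pow_succ, sumFn]; ring
    rw [Finset.sum_congr rfl e1, Finset.sum_congr rfl e2, Finset.sum_add_distrib,
      ← Finset.mul_sum, ← Finset.mul_sum, ← Finset.mul_sum, ih, sum_wt]
    ring

lemma wt_nonneg (q : ℝ) (hq : q ∈ Set.Ioo (0:ℝ) 1) (N : ℕ) (J : Finset ℕ) : 0 ≤ wt q N J := by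
  have := hq.1; have : 0 < 1 - q := by linarith [hq.2]
  unfold wt; positivity

lemma wt_full (q : ℝ) (hq : q ∈ Set.Ioo (0:ℝ) 1) (N : ℕ) :
    1 - wt q N (Finset.range N) ≤ N * (1 - q) := by
  have := one_add_mul_le_pow (a := q - 1) (by linarith [hq.1]) N
  simp only [wt, Finset.card_range, Nat.sub_self, pow_zero, mul_one]
  rw [add_sub_cancel] at this
  linarith

lemma sumFn_le (g : ℕ → ℝ) (N N' : ℕ) (h : N ≤ N') (J : Finset ℕ) (hJ : J ∈ (Finset.range N).powerset) :
    |sumFn g J| ≤ ∑ j ∈ Finset.range N', |g j| := by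
  refine (Finset.abs_sum_le_sum_abs _ _).trans ?_
  apply Finset.sum_le_sum_of_subset_of_nonneg
  · exact (Finset.mem_powerset.1 hJ).trans (Finset.range_mono h)
  · intros; positivity

noncomputable def dens (g : ℕ → ℝ) (q σ : ℝ) (N : ℕ) (y : ℝ) : ℝ :=
  ∑ J ∈ (Finset.range N).powerset, wt q N J * gaussianPDFReal (sumFn g J) (σ ^ 2).toNNReal y

noncomputable def mixM (g : ℕ → ℝ) (q σ : ℝ) (N : ℕ) : Measure ℝ :=
  ∑ J ∈ (Finset.range N).powerset,
    ENNReal.ofReal (wt q N J) • gaussianReal (sumFn g J) (σ ^ 2).toNNReal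

lemma dens_meas (g : ℕ → ℝ) (q σ : ℝ) (N : ℕ) : Measurable (dens g q σ N) := by
  unfold dens
  exact Finset.measurable_fun_sum _ fun J _ => (measurable_gaussianPDFReal _ _).const_mul _

lemma dens_pos (g : ℕ → ℝ) (q σ : ℝ) (hq : q ∈ Set.Ioo (0:ℝ) 1) (hσ : 0 < σ) (N : ℕ) (y : ℝ) :
    0 < dens g q σ N y := by
  have h1 := hq.1
  have h2 : 0 < 1 - q := by linarith [hq.2]
  have hv : (σ ^ 2).toNNReal ≠ 0 := by
    have : 0 < (σ ^ 2).toNNReal := Real.toNNReal_pos.2 (by positivity)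
    exact this.ne'
  unfold dens
  apply Finset.sum_pos
  · intro J _
    have := gaussianPDFReal_pos (sumFn g J) _ y hv
    unfold wt; positivity
  · exact ⟨∅, by simp⟩

lemma mixM_eq (g : ℕ → ℝ) (q σ : ℝ) (hq : q ∈ Set.Ioo (0:ℝ) 1) (hσ : 0 < σ) (N : ℕ) :
    mixM g q σ N = volume.withDensity (fun y => ENNReal.ofReal (dens g q σ N y)) := by
  have hv : (σ ^ 2).toNNReal ≠ 0 := by
    have : 0 < (σ ^ 2).toNNReal := Real.toNNReal_pos.2 (by positivity)
    exact this.ne'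
  ext S hS
  rw [withDensity_apply _ hS, mixM, Measure.finsetSum_apply]
  have : ∀ y, ENNReal.ofReal (dens g q σ N y) = ∑ J ∈ (Finset.range N).powerset,
      ENNReal.ofReal (wt q N J) * gaussianPDF (sumFn g J) (σ ^ 2).toNNReal y := by
    intro y
    rw [dens, ENNReal.ofReal_sum_of_nonneg]
    · apply Finset.sum_congr rfl
      intro J _
      rw [ENNReal.ofReal_mul (wt_nonneg q hq N J), gaussianPDF]
    · intro J _
      exact mul_nonneg (wt_nonneg q hq N J) (gaussianPDFReal_nonneg _ _ _)
  simp_rw [this]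
  rw [lintegral_finsetSum _ fun J _ => (measurable_gaussianPDF _ _).const_mul _]
  apply Finset.sum_congr rfl
  intro J _
  rw [lintegral_const_mul _ (measurable_gaussianPDF _ _), Measure.smul_apply, smul_eq_mul,
    gaussianReal_apply _ hv]

lemma loss_ae (n : ℕ) (g : ℕ → ℝ) (q σ : ℝ) (hq : q ∈ Set.Ioo (0:ℝ) 1) (hσ : 0 < σ) :
    ∀ᵐ y ∂(volume : Measure ℝ), privacyLoss n σ q (sumFn g) y
      = Real.log (dens g q σ (n + 1) y) - Real.log (dens g q σ n y) := by
  have hP : subsampledP n σ q (sumFn g) = mixM g q σ (n + 1) := rfl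
  have hQ : subsampledQ n σ q (sumFn g) = mixM g q σ n := rfl
  have fin : ∀ N, IsFiniteMeasure (mixM g q σ N) := by
    intro N
    refine ⟨?_⟩
    rw [mixM, Measure.finsetSum_apply]
    refine ENNReal.sum_lt_top.2 fun J _ => ?_
    simp
  have hac : ∀ N, mixM g q σ N ≪ volume := fun N => by
    rw [mixM_eq g q σ hq hσ]; exact withDensity_absolutelyContinuous _ _
  have hac' : ∀ N, volume ≪ mixM g q σ N := fun N => by
    rw [mixM_eq g q σ hq hσ]
    refine withDensity_absolutelyContinuous' ?_ ?_
    · exact (dens_meas g q σ N).ennreal_ofReal.aemeasurable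
    · refine ae_of_all _ fun y => ?_
      simpa using dens_pos g q σ hq hσ N y
  have := fin n
  have := fin (n + 1)
  have h1 := hac' n (Measure.rnDeriv_eq_div (hac (n+1)) (hac n))
  have hrn : ∀ N, (mixM g q σ N).rnDeriv volume =ᵐ[volume] fun y => ENNReal.ofReal (dens g q σ N y) :=
    fun N => by
      rw [mixM_eq g q σ hq hσ]
      exact Measure.rnDeriv_withDensity _ (dens_meas g q σ N).ennreal_ofReal
  filter_upwards [h1, hrn n, hrn (n + 1)] with y a1 a2 a3
  rw [privacyLoss, hP, hQ, a1, a2, a3, ENNReal.toReal_div,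
    ENNReal.toReal_ofReal (dens_pos g q σ hq hσ _ y).le,
    ENNReal.toReal_ofReal (dens_pos g q σ hq hσ _ y).le,
    Real.log_div (dens_pos g q σ hq hσ _ y).ne' (dens_pos g q σ hq hσ _ y).ne']

lemma logdens {ι : Type*} [DecidableEq ι] (s : Finset ι) (w m : ι → ℝ) (i0 : ι) (hi0 : i0 ∈ s)
    (hw : ∀ i ∈ s, 0 ≤ w i) (hsum : ∑ i ∈ s, w i = 1) (κ H σ : ℝ) (hσ : 0 < σ)
    (hhalf : 1 / 2 ≤ w i0)
    (hκ : 1 - w i0 ≤ κ) (hκ1 : κ ≤ 1) (hm : ∀ i ∈ s, |m i| ≤ H) (y t : ℝ)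
    (ht : t = 2 * H * (|y| + H) / σ ^ 2) :
    |Real.log (∑ i ∈ s, w i * gaussianPDFReal (m i) (σ ^ 2).toNNReal y) -
      (Real.log ((Real.sqrt (2 * Real.pi * σ ^ 2))⁻¹) - y ^ 2 / (2 * σ ^ 2)
        + y * (∑ i ∈ s, w i * m i) / σ ^ 2 - (∑ i ∈ s, w i * (m i) ^ 2) / (2 * σ ^ 2))|
      ≤ 3 * κ * (t ^ 2 * Real.exp (2 * t)) := by
  have hH : 0 ≤ H := (abs_nonneg _).trans (hm i0 hi0)
  set θ : ι → ℝ := fun i => -(y - m i) ^ 2 / (2 * σ ^ 2) - -(y - m i0) ^ 2 / (2 * σ ^ 2) with hθ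
  have hA := lemA s w θ i0 hi0 hw hsum κ t hhalf hκ hκ1 (by simp [hθ]) (by
    intro i hi
    have e : θ i = (m i - m i0) * (2 * y - m i - m i0) / (2 * σ ^ 2) := by
      simp only [hθ]; ring
    rw [e, ht, abs_div, abs_mul, abs_of_pos (show 0 < 2 * σ ^ 2 by positivity)]
    have h1 := abs_le.1 (hm i hi)
    have h2 := abs_le.1 (hm i0 hi0)
    have b1 : |m i - m i0| ≤ 2 * H := abs_le.2 ⟨by linarith, by linarith⟩
    have b2 : |2 * y - m i - m i0| ≤ 2 * (|y| + H) := by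
      have := le_abs_self y
      have := neg_abs_le y
      exact abs_le.2 ⟨by linarith, by linarith⟩
    calc _ ≤ (2 * H) * (2 * (|y| + H)) / (2 * σ ^ 2) := by gcongr
      _ = _ := by field_simp)
  have hv : (((σ ^ 2).toNNReal : NNReal) : ℝ) = σ ^ 2 := Real.coe_toNNReal _ (by positivity)
  have e1 : ∑ i ∈ s, w i * gaussianPDFReal (m i) (σ ^ 2).toNNReal y
      = ((Real.sqrt (2 * Real.pi * σ ^ 2))⁻¹ * Real.exp (-(y - m i0) ^ 2 / (2 * σ ^ 2)))
        * ∑ i ∈ s, w i * Real.exp (θ i) := by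
    rw [Finset.mul_sum]
    apply Finset.sum_congr rfl
    intro i _
    have : Real.exp (-(y - m i) ^ 2 / (2 * σ ^ 2)) = Real.exp (-(y - m i0) ^ 2 / (2 * σ ^ 2)) * Real.exp (θ i) := by
      rw [← Real.exp_add]; congr 1; simp only [hθ]; ring
    rw [gaussianPDFReal, hv, this]; ring
  have hG : 0 < ∑ i ∈ s, w i * Real.exp (θ i) := by
    have : w i0 * Real.exp (θ i0) ≤ ∑ i ∈ s, w i * Real.exp (θ i) :=
      Finset.single_le_sum (f := fun i => w i * Real.exp (θ i))
        (fun i hi => mul_nonneg (hw i hi) (Real.exp_pos _).le) hi0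
    refine lt_of_lt_of_le ?_ this
    have : 0 < w i0 := by linarith
    positivity
  have e2 : ∑ i ∈ s, w i * θ i = - y ^ 2 / (2 * σ ^ 2) + y * (∑ i ∈ s, w i * m i) / σ ^ 2
      - (∑ i ∈ s, w i * (m i) ^ 2) / (2 * σ ^ 2) - -(y - m i0) ^ 2 / (2 * σ ^ 2) := by
    have : ∀ i, w i * θ i = w i * (- y ^ 2 / (2 * σ ^ 2) - -(y - m i0) ^ 2 / (2 * σ ^ 2)) + (w i * m i) * (y / σ ^ 2)
        - (w i * m i ^ 2) * (1 / (2 * σ ^ 2)) := by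
      intro i; simp only [hθ]; field_simp; ring
    simp_rw [this]
    rw [Finset.sum_sub_distrib, Finset.sum_add_distrib, ← Finset.sum_mul, ← Finset.sum_mul,
      ← Finset.sum_mul, hsum]
    ring
  rw [e1, Real.log_mul (by positivity) hG.ne', Real.log_mul (by positivity) (by positivity), Real.log_exp]
  rw [e2] at hA
  refine le_of_eq_of_le ?_ hA
  congr 1; ring

lemma t_bound (H σ y m z t : ℝ) (hH : 0 ≤ H) (hσ : 1 ≤ σ) (hm : |m| ≤ H) (hy : y = m + σ * z)
    (ht : t = 2 * H * (|y| + H) / σ ^ 2) :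
    t ^ 2 * Real.exp (2 * t) ≤ 2 * Real.exp (12 * H ^ 2) * Real.exp (6 * H * |z|) / σ ^ 2 := by
  have hσ0 : 0 < σ := by linarith
  set r := 2 * H * (|z| + 2 * H) with hr
  have hr0 : 0 ≤ r := by positivity
  have ht0 : 0 ≤ t := by rw [ht]; positivity
  have h1 : |y| ≤ H + σ * |z| := by
    rw [hy]
    refine (abs_add_le _ _).trans ?_
    rw [abs_mul, abs_of_pos hσ0]; linarith
  have h2 : t ≤ r / σ := by
    have : |y| + H ≤ σ * (|z| + 2 * H) := by nlinarith
    rw [ht, hr]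
    calc _ ≤ 2 * H * (σ * (|z| + 2 * H)) / σ ^ 2 := by gcongr
      _ = _ := by field_simp
  have h3 : r / σ ≤ r := div_le_self hr0 hσ
  have h4 : r ^ 2 ≤ 2 * Real.exp r := by
    have := Real.quadratic_le_exp_of_nonneg hr0
    linarith
  calc t ^ 2 * Real.exp (2 * t) ≤ (r / σ) ^ 2 * Real.exp (2 * r) := by
        have : t ≤ r := h2.trans h3
        gcongr
    _ = r ^ 2 * Real.exp (2 * r) / σ ^ 2 := by ring
    _ ≤ 2 * Real.exp r * Real.exp (2 * r) / σ ^ 2 := by gcongr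
    _ = _ := by
        rw [mul_assoc, ← Real.exp_add, mul_assoc, ← Real.exp_add]
        congr 3; rw [hr]; ring_nf

set_option maxHeartbeats 800000 in
lemma main_bound (n : ℕ) (g : ℕ → ℝ) (N : ℕ) (hN : N ≤ n + 1) :
    ∃ C > (0 : ℝ), ∀ q ∈ Set.Ioo (0 : ℝ) 1, 1 - q ≤ 1 / (2 * (n + 1)) → ∀ σ : ℝ, 1 ≤ σ →
        (∫ y, |privacyLoss n σ q (sumFn g) y -
              ∫ z, privacyLoss n σ q (sumFn g) z ∂(mixM g q σ N)| ^ 3 ∂(mixM g q σ N))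
          ≤ |g n| ^ 3 * Real.sqrt (8 / Real.pi) / σ ^ 3 + C * ((1 - q) / σ ^ 4) := by
  set H := ∑ j ∈ Finset.range (n + 1), |g j| with hHdef
  have hH : 0 ≤ H := Finset.sum_nonneg fun _ _ => abs_nonneg _
  set K1 := 12 * (n + 1) * Real.exp (12 * H ^ 2) with hK1
  have hK10 : 0 ≤ K1 := by positivity
  set K := K1 + |g n| * (2 * H) + (n + 2) with hKd
  have hK0 : 0 ≤ K := by positivity
  obtain ⟨C, hC, hB⟩ := lemB (Finset ℕ) K (6 * H) |g n| hK0 (by positivity) (abs_nonneg _)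
  refine ⟨C, hC, ?_⟩
  intro q hq hqε σ hσ
  have hσ0 : 0 < σ := by linarith
  have hp0 : 0 < 1 - q := by linarith [hq.2]
  set L : ℝ → ℝ := fun y => Real.log (dens g q σ (n + 1) y) - Real.log (dens g q σ n y) with hL
  have hae : ∀ᵐ y ∂(mixM g q σ N), privacyLoss n σ q (sumFn g) y = L y := by
    have hac : mixM g q σ N ≪ volume := by
      rw [mixM_eq g q σ hq hσ0]; exact withDensity_absolutelyContinuous _ _
    exact hac (loss_ae n g q σ hq hσ0)
  have hI : ∫ z, privacyLoss n σ q (sumFn g) z ∂(mixM g q σ N) = ∫ z, L z ∂(mixM g q σ N) :=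
    integral_congr_ae hae
  rw [hI]
  have hI2 : ∫ y, |privacyLoss n σ q (sumFn g) y - ∫ z, L z ∂(mixM g q σ N)| ^ 3 ∂(mixM g q σ N)
      = ∫ y, |L y - ∫ z, L z ∂(mixM g q σ N)| ^ 3 ∂(mixM g q σ N) := by
    apply integral_congr_ae
    filter_upwards [hae] with y hy
    rw [hy]
  rw [hI2]
  have hnp : ((n:ℝ) + 1) * (1 - q) ≤ 1 / 2 := by
    have : (0:ℝ) < 2 * (n + 1) := by positivity
    rw [le_div_iff₀ this] at hqε
    linarith
  have hfull : ∀ M, M ≤ n + 1 → 1 - wt q M (Finset.range M) ≤ (n + 1) * (1 - q) := by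
    intro M hM
    refine (wt_full q hq M).trans ?_
    have : (M:ℝ) ≤ n + 1 := by exact_mod_cast hM
    gcongr
  have hld : ∀ M, M ≤ n + 1 → ∀ y t, t = 2 * H * (|y| + H) / σ ^ 2 → _ := fun M hM y t ht =>
    logdens (Finset.range M).powerset (wt q M) (sumFn g) (Finset.range M) (by simp)
      (fun J _ => wt_nonneg q hq M J) (sum_wt q M) ((n + 1) * (1 - q)) H σ hσ0
      (by linarith [hfull M hM]) (hfull M hM) (by linarith)
      (fun J hJ => sumFn_le g M (n + 1) hM J hJ) y t ht
  set S : ℕ → ℝ := fun M => (∑ J ∈ (Finset.range M).powerset, wt q M J * sumFn g J ^ 2) / (2 * σ ^ 2) with hS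
  set a0 := S n - S (n + 1) with ha0
  have hexp : ∀ y t, t = 2 * H * (|y| + H) / σ ^ 2 →
      |L y - (a0 + y * (q * g n) / σ ^ 2)| ≤ 6 * ((n + 1) * (1 - q)) * (t ^ 2 * Real.exp (2 * t)) := by
    intro y t ht
    have h1 := hld (n + 1) le_rfl y t ht
    have h2 := hld n (Nat.le_succ n) y t ht
    rw [mean_wt] at h1 h2
    rw [Finset.sum_range_succ] at h1
    have h3 := (abs_sub _ _).trans (add_le_add h1 h2)
    refine le_of_eq_of_le ?_ (h3.trans (le_of_eq ?_))
    · congr 1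
      simp only [hL, ha0, hS, dens]
      ring
    · ring
  set κ : Finset ℕ → ℝ := fun J => if J = Finset.range N then 1 - q else 1 with hκ
  have hmem : Finset.range N ∈ (Finset.range N).powerset := by simp
  refine (hB (Finset.range N).powerset (wt q N) (sumFn g) κ σ (1 - q) (q * g n)
    (a0 + sumFn g (Finset.range N) * (q * g n) / σ ^ 2) L hσ hp0.le
    (fun J _ => wt_nonneg q hq N J) (sum_wt q N) ?_ ?_ ?_ ?_ ?_ ?_)
  · intro J _
    simp only [hκ]; split_ifs
    · exact le_rfl
    · linarith [hq.1]
  · intro J _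
    simp only [hκ]; split_ifs
    · linarith [hq.1]
    · exact le_rfl
  · have hw1 := sum_wt q N
    rw [← Finset.add_sum_erase _ _ hmem] at hw1 ⊢
    have : ∑ J ∈ (Finset.range N).powerset.erase (Finset.range N), wt q N J * κ J
        = ∑ J ∈ (Finset.range N).powerset.erase (Finset.range N), wt q N J := by
      apply Finset.sum_congr rfl
      intro J hJ
      simp only [hκ]
      rw [if_neg (Finset.ne_of_mem_erase hJ), mul_one]
    rw [this]
    have hs0 : 0 ≤ ∑ J ∈ (Finset.range N).powerset.erase (Finset.range N), wt q N J :=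
      Finset.sum_nonneg fun J _ => wt_nonneg q hq N J
    have h1 := hfull N hN
    have h2 : κ (Finset.range N) = 1 - q := by simp [hκ]
    rw [h2]
    have h3 : wt q N (Finset.range N) * (1 - q) ≤ 1 * (1 - q) := by
      apply mul_le_mul_of_nonneg_right _ hp0.le; linarith
    have h4 : ((n:ℝ) + 2) * (1 - q) ≤ K * (1 - q) := by
      apply mul_le_mul_of_nonneg_right _ hp0.le
      rw [hKd]
      have : 0 ≤ |g n| * (2 * H) := by positivity
      linarith
    linarith
  · rw [abs_mul, abs_of_pos hq.1]
    exact mul_le_of_le_one_left (abs_nonneg _) hq.2.le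
  · exact (Real.measurable_log.comp (dens_meas g q σ (n + 1))).sub
      (Real.measurable_log.comp (dens_meas g q σ n))
  · intro J hJ z
    have hJm := sumFn_le g N (n + 1) hN J hJ
    have hFm := sumFn_le g N (n + 1) hN _ hmem
    have h1 := hexp (sumFn g J + σ * z) _ rfl
    have h2 := t_bound H σ _ (sumFn g J) z _ hH hσ hJm rfl rfl
    have h3 := h1.trans (mul_le_mul_of_nonneg_left h2 (by positivity))
    set e := Real.exp (6 * H * |z|) with he
    have he1 : 1 ≤ e := Real.one_le_exp (by positivity)
    have h4 : |L (sumFn g J + σ * z) - (a0 + sumFn g (Finset.range N) * (q * g n) / σ ^ 2) - q * g n * z / σ|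
        ≤ (1 - q) * (K1 * e) / σ ^ 2 + |g n| * |sumFn g J - sumFn g (Finset.range N)| / σ ^ 2 := by
      have d1 : L (sumFn g J + σ * z) - (a0 + sumFn g (Finset.range N) * (q * g n) / σ ^ 2) - q * g n * z / σ
        = (L (sumFn g J + σ * z) - (a0 + (sumFn g J + σ * z) * (q * g n) / σ ^ 2))
          + q * (g n * (sumFn g J - sumFn g (Finset.range N))) / σ ^ 2 := by
        field_simp; ring
      rw [d1]
      refine (abs_add_le _ _).trans (add_le_add (h3.trans (le_of_eq ?_)) ?_)
      · rw [hK1]; ring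
      · rw [abs_div, abs_mul, abs_mul, abs_of_pos hq.1, abs_of_pos (show 0 < σ ^ 2 by positivity)]
        exact div_le_div_of_nonneg_right
          (mul_le_of_le_one_left (by positivity) hq.2.le) (by positivity)
    refine h4.trans ?_
    by_cases hJe : J = Finset.range N
    · have hk : κ J = 1 - q := by simp [hκ, hJe]
      rw [hk, hJe, sub_self, abs_zero, mul_zero, zero_div, add_zero]
      have : K1 ≤ K := by
        rw [hKd]
        have : 0 ≤ |g n| * (2 * H) := by positivity
        have : (0:ℝ) ≤ n := Nat.cast_nonneg n
        linarith
      gcongr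
    · have hk : κ J = 1 := by simp [hκ, hJe]
      rw [hk, ← add_div]
      have d : |sumFn g J - sumFn g (Finset.range N)| ≤ 2 * H := by
        refine (abs_sub _ _).trans ?_; linarith
      have d2 : (1 - q) * (K1 * e) ≤ 1 * (K1 * e) :=
        mul_le_mul_of_nonneg_right (by linarith [hq.1]) (by positivity)
      have d3 : |g n| * |sumFn g J - sumFn g (Finset.range N)| ≤ |g n| * (2 * H) * e := by
        refine (mul_le_mul_of_nonneg_left d (abs_nonneg _)).trans ?_
        exact le_mul_of_one_le_right (by positivity) he1
      have d4 : 0 ≤ ((n:ℝ) + 2) * e := by positivity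
      apply div_le_div_of_nonneg_right _ (by positivity)
      rw [hKd]
      linarith

theorem subsampledGaussian_third_moment_privacyLoss_large_q
    (n : ℕ) (g : ℕ → ℝ) :
    ∃ C > (0 : ℝ), ∃ ε ∈ Set.Ioo (0 : ℝ) 1, ∃ σ₀ > (0 : ℝ),
      ∀ q ∈ Set.Ioo (0 : ℝ) 1, 1 - q ≤ ε → ∀ σ : ℝ, σ₀ ≤ σ →
        (∫ y, |privacyLoss n σ q (sumFn g) y -
              ∫ z, privacyLoss n σ q (sumFn g) z ∂(subsampledP n σ q (sumFn g))| ^ 3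
            ∂(subsampledP n σ q (sumFn g)))
          ≤ (2 - q ^ 3) * Real.sqrt (8 / Real.pi) * |g n| ^ 3 / σ ^ 3 +
              C * ((1 - q) / σ ^ 4 + (1 - q) ^ 2) ∧
        (∫ y, |privacyLoss n σ q (sumFn g) y -
              ∫ z, privacyLoss n σ q (sumFn g) z ∂(subsampledQ n σ q (sumFn g))| ^ 3
            ∂(subsampledQ n σ q (sumFn g)))
          ≤ (2 - q ^ 3) * Real.sqrt (8 / Real.pi) * |g n| ^ 3 / σ ^ 3 +
              C * ((1 - q) / σ ^ 4 + (1 - q) ^ 2) := by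
  obtain ⟨C1, hC1, h1⟩ := main_bound n g (n + 1) le_rfl
  obtain ⟨C2, hC2, h2⟩ := main_bound n g n (Nat.le_succ n)
  refine ⟨C1 + C2, by positivity, 1 / (2 * (n + 1)), ⟨by positivity, ?_⟩, 1, one_pos, ?_⟩
  · rw [div_lt_one (by positivity)]
    have : (0:ℝ) ≤ n := Nat.cast_nonneg n
    linarith
  intro q hq hqε σ hσ
  have hσ0 : 0 < σ := by linarith
  have hp0 : 0 < 1 - q := by linarith [hq.2]
  have hq3 : q ^ 3 ≤ 1 := pow_le_one₀ hq.1.le hq.2.le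
  have key : ∀ C, 0 < C → C ≤ C1 + C2 →
      |g n| ^ 3 * Real.sqrt (8 / Real.pi) / σ ^ 3 + C * ((1 - q) / σ ^ 4) ≤
      (2 - q ^ 3) * Real.sqrt (8 / Real.pi) * |g n| ^ 3 / σ ^ 3 +
              (C1 + C2) * ((1 - q) / σ ^ 4 + (1 - q) ^ 2) := by
    intro C hC hCC
    apply add_le_add
    · have : 1 * (|g n| ^ 3 * Real.sqrt (8 / Real.pi) / σ ^ 3)
          ≤ (2 - q ^ 3) * (|g n| ^ 3 * Real.sqrt (8 / Real.pi) / σ ^ 3) :=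
        mul_le_mul_of_nonneg_right (by linarith) (by positivity)
      refine le_of_eq_of_le (one_mul _).symm (this.trans (le_of_eq (by ring)))
    · have : (1 - q) / σ ^ 4 ≤ (1 - q) / σ ^ 4 + (1 - q) ^ 2 := by
        have : 0 ≤ (1 - q) ^ 2 := by positivity
        linarith
      gcongr
  exact ⟨(h1 q hq hqε σ hσ).trans (key C1 hC1 (by linarith)),
    (h2 q hq hqε σ hσ).trans (key C2 hC2 (by linarith))⟩
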